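/- Let H be a separable complex Hilbert space, 1 < p < ∞ and p' = p/(p−1). Let N : B(H) → B(H) be a bounded linear map whose restriction to the trace class S^1 maps S^1 into itself boundedly. Then for every X ∈ S^p and every finite rank operator K on H, one has |tr(K N(X))| ≤ (‖N‖_{B→B} · tr |K|^{p'})^{1/p'} · (‖N‖_{S^1→S^1} · tr |X|^{p})^{1/p}, where |X| = (X*X)^{1/2} and |K| = (K*K)^{1/2}. -/

import Mathlib

open scoped ENNReal InnerProductSpace

noncomputable section

variable {H : Type*} [NormedAddCommGroup H] [InnerProductSpace ℂ H] [CompleteSpace H]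

/-- `|T|^q = (T^* T)^{q/2}`, defined via the continuous functional calculus. -/
def absPow (T : H →L[ℂ] H) (q : ℝ) : H →L[ℂ] H :=
  cfc (fun x : ℝ => x ^ (q / 2)) (ContinuousLinearMap.adjoint T * T)

/-- `tr |T|^q ∈ [0,∞]`, computed via the diagonal matrix elements in the Hilbert
basis `b`.  For `q = 1` this is the trace norm `‖T‖_{S¹}`, and `T` belongs to the
Schatten class `S^q` precisely when this quantity is finite. -/
def trAbsPow {ι : Type*} (b : HilbertBasis ι ℂ H) (T : H →L[ℂ] H) (q : ℝ) : ℝ≥0∞ :=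
  ∑' i, ENNReal.ofReal (⟪b i, (absPow T q) (b i)⟫_ℂ).re

/-- The trace `tr T = ∑ᵢ ⟨bᵢ, T bᵢ⟩` (a convergent sum when `T` is trace class). -/
def traceC {ι : Type*} (b : HilbertBasis ι ℂ H) (T : H →L[ℂ] H) : ℂ :=
  ∑' i, ⟪b i, T (b i)⟫_ℂ

/-- The norm `‖N‖_{S¹ → S¹} ∈ [0,∞]` of `N` as a map on the trace class. -/
def trClassOpNorm {ι : Type*} (b : HilbertBasis ι ℂ H)
    (N : (H →L[ℂ] H) →L[ℂ] (H →L[ℂ] H)) : ℝ≥0∞ :=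
  sInf {C : ℝ≥0∞ | ∀ T : H →L[ℂ] H, trAbsPow b (N T) 1 ≤ C * trAbsPow b T 1}

open ContinuousLinearMap Filter Topology

/-- **Parseval's identity** in `[0, ∞]`. -/
lemma HilbertBasis.tsum_enorm_inner_sq {ι E : Type*} [NormedAddCommGroup E]
    [InnerProductSpace ℂ E] (b : HilbertBasis ι ℂ E) (x : E) :
    ∑' i, ‖⟪b i, x⟫_ℂ‖ₑ ^ 2 = ‖x‖ₑ ^ 2 := by
  have h : HasSum (fun i => ‖⟪b i, x⟫_ℂ‖ ^ 2) (‖x‖ ^ 2) := by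
    have := (b.hasSum_inner_mul_inner x x).mapL Complex.reCLM
    convert this using 1
    · ext i
      rw [← inner_conj_symm, RCLike.norm_conj, RCLike.mul_conj]
      simp [← Complex.ofReal_pow]
    · simp [inner_self_eq_norm_sq_to_K, ← Complex.ofReal_pow]
  have h2 := ENNReal.ofReal_tsum_of_nonneg (fun i => by positivity) h.summable
  rw [h.tsum_eq] at h2
  simpa [ENNReal.ofReal_pow, ofReal_norm] using h2.symm

lemma HilbertBasis.tsum_enorm_apply_sq_adjoint {ι : Type*} (b : HilbertBasis ι ℂ H)
    (S : H →L[ℂ] H) : ∑' i, ‖S (b i)‖ₑ ^ 2 = ∑' i, ‖adjoint S (b i)‖ₑ ^ 2 := by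
  simp_rw [← b.tsum_enorm_inner_sq]
  rw [ENNReal.tsum_comm]
  refine tsum_congr fun j => tsum_congr fun i => ?_
  rw [adjoint_inner_right, ← inner_conj_symm, RCLike.enorm_conj]

lemma HilbertBasis.tsum_enorm_mul_apply_sq_le {ι E : Type*} [NormedAddCommGroup E]
    [InnerProductSpace ℂ E] (b : HilbertBasis ι ℂ E)
    (Z S : E →L[ℂ] E) :
    ∑' i, ‖(Z * S) (b i)‖ₑ ^ 2 ≤ ‖Z‖ₑ ^ 2 * ∑' i, ‖S (b i)‖ₑ ^ 2 := by
  rw [← ENNReal.tsum_mul_left]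
  gcongr with i
  rw [← mul_pow]
  gcongr
  exact Z.le_opENorm (S (b i))

/-- For self-adjoint `S`, the diagonal of `Z₁ S² Z₂` is absolutely summable, with the expected
bound in terms of the Hilbert–Schmidt norm of `S`. -/
lemma HilbertBasis.sum_enorm_inner_mul_sq_mul_le {ι : Type*} (b : HilbertBasis ι ℂ H)
    {S : H →L[ℂ] H} (hS : IsSelfAdjoint S) (Z₁ Z₂ : H →L[ℂ] H) (s : Finset ι) :
    ∑ i ∈ s, ‖⟪b i, (Z₁ * (S * S) * Z₂) (b i)⟫_ℂ‖ₑ ≤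
      ‖Z₁‖ₑ * ‖Z₂‖ₑ * ∑' i, ‖S (b i)‖ₑ ^ 2 := by
  have hS' : adjoint S = S := hS
  set M := ∑' i, ‖S (b i)‖ₑ ^ 2
  have h1 : ∑ i ∈ s, ‖(S * adjoint Z₁) (b i)‖ₑ ^ 2 ≤ ‖Z₁‖ₑ ^ 2 * M := by
    refine (ENNReal.sum_le_tsum s).trans ?_
    rw [b.tsum_enorm_apply_sq_adjoint]
    have : adjoint (S * adjoint Z₁) = Z₁ * S := by
      change star (S * star Z₁) = _
      rw [star_mul, star_star, hS.star_eq]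
    rw [this]
    exact b.tsum_enorm_mul_apply_sq_le _ _
  have h2 : ∑ i ∈ s, ‖(S * Z₂) (b i)‖ₑ ^ 2 ≤ ‖Z₂‖ₑ ^ 2 * M := by
    refine (ENNReal.sum_le_tsum s).trans ?_
    rw [b.tsum_enorm_apply_sq_adjoint]
    have : adjoint (S * Z₂) = adjoint Z₂ * S := by
      change star (S * Z₂) = _
      rw [star_mul, hS.star_eq]; rfl
    rw [this]
    refine (b.tsum_enorm_mul_apply_sq_le _ _).trans_eq ?_
    congr 2
    exact (adjoint : (H →L[ℂ] H) ≃ₗᵢ⋆[ℂ] _).enorm_map Z₂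
  have h0 : ∀ i, ‖⟪b i, (Z₁ * (S * S) * Z₂) (b i)⟫_ℂ‖ₑ ≤
      ‖(S * adjoint Z₁) (b i)‖ₑ * ‖(S * Z₂) (b i)‖ₑ := by
    intro i
    have : ⟪b i, (Z₁ * (S * S) * Z₂) (b i)⟫_ℂ = ⟪(S * adjoint Z₁) (b i), (S * Z₂) (b i)⟫_ℂ := by
      change ⟪b i, Z₁ (S (S (Z₂ (b i))))⟫_ℂ = ⟪S (adjoint Z₁ (b i)), S (Z₂ (b i))⟫_ℂ
      rw [← adjoint_inner_left, ← adjoint_inner_left, hS']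
    rw [this]
    simp only [enorm, ← ENNReal.coe_mul]
    exact_mod_cast nnnorm_inner_le_nnnorm _ _
  refine (Finset.sum_le_sum fun i _ => h0 i).trans ?_
  refine (ENNReal.inner_le_Lp_mul_Lq s _ _ Real.HolderConjugate.two_two).trans ?_
  simp only [ENNReal.rpow_two]
  refine (mul_le_mul' (ENNReal.rpow_le_rpow h1 (by norm_num))
    (ENNReal.rpow_le_rpow h2 (by norm_num))).trans_eq ?_
  have hsq : ∀ a : ℝ≥0∞, (a ^ 2) ^ (1 / 2 : ℝ) = a := fun a => by
    rw [← ENNReal.rpow_two, ← ENNReal.rpow_mul]; norm_num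
  rw [ENNReal.mul_rpow_of_nonneg _ _ (by norm_num), ENNReal.mul_rpow_of_nonneg _ _ (by norm_num),
    hsq, hsq]
  have hM : M ^ (1 / 2 : ℝ) * M ^ (1 / 2 : ℝ) = M := by
    rw [← ENNReal.rpow_add_of_nonneg _ _ (by norm_num) (by norm_num)]; norm_num
  calc _ = ‖Z₁‖ₑ * ‖Z₂‖ₑ * (M ^ (1 / 2 : ℝ) * M ^ (1 / 2 : ℝ)) := by ring
    _ = _ := by rw [hM]

lemma adjoint_mul_self_nonneg (T : H →L[ℂ] H) : 0 ≤ adjoint T * T := star_mul_self_nonneg T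

lemma adjoint_mul_self_isSelfAdjoint (T : H →L[ℂ] H) : IsSelfAdjoint (adjoint T * T) :=
  .of_nonneg (adjoint_mul_self_nonneg T)

lemma spectrum_adjoint_mul_self_nonneg (T : H →L[ℂ] H) {x : ℝ}
    (hx : x ∈ spectrum ℝ (adjoint T * T)) : 0 ≤ x :=
  spectrum_nonneg_of_nonneg (adjoint_mul_self_nonneg T) hx

lemma absPow_isSelfAdjoint (T : H →L[ℂ] H) (q : ℝ) : IsSelfAdjoint (absPow T q) :=
  cfc_predicate _ _

lemma absPow_mul_absPow (T : H →L[ℂ] H) {q r : ℝ} (hq : 0 ≤ q) (hr : 0 ≤ r) :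
    absPow T q * absPow T r = absPow T (q + r) := by
  have hc : ∀ s : ℝ, 0 ≤ s → Continuous fun x : ℝ => x ^ (s / 2) := fun s hs =>
    Real.continuous_rpow_const (by positivity)
  rw [absPow, absPow, ← cfc_mul _ _ _ (hc q hq).continuousOn (hc r hr).continuousOn]
  refine cfc_congr fun x hx => ?_
  have h0 := spectrum_adjoint_mul_self_nonneg T hx
  rw [← Real.rpow_add_of_nonneg h0 (by positivity) (by positivity), add_div]

lemma absPow_two (T : H →L[ℂ] H) : absPow T 2 = adjoint T * T := by
  have h := adjoint_mul_self_isSelfAdjoint T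
  simp only [absPow, div_self (two_ne_zero' ℝ), Real.rpow_one]
  exact cfc_id' ℝ _

lemma trAbsPow_eq_tsum_enorm_sq {ι : Type*} (b : HilbertBasis ι ℂ H) (T : H →L[ℂ] H) {q : ℝ}
    (hq : 0 ≤ q) : trAbsPow b T q = ∑' i, ‖absPow T (q / 2) (b i)‖ₑ ^ 2 := by
  refine tsum_congr fun i => ?_
  have hs : adjoint (absPow T (q / 2)) = absPow T (q / 2) := absPow_isSelfAdjoint T _
  have hq2 : absPow T q = absPow T (q / 2) * absPow T (q / 2) := by
    rw [absPow_mul_absPow T (by positivity) (by positivity), add_halves]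
  have hi : ⟪b i, absPow T q (b i)⟫_ℂ = ⟪absPow T (q / 2) (b i), absPow T (q / 2) (b i)⟫_ℂ := by
    rw [← adjoint_inner_right, hs, hq2]; rfl
  rw [hi, inner_self_eq_norm_sq_to_K]
  simp [← Complex.ofReal_pow, ENNReal.ofReal_pow, ofReal_norm]

lemma adjoint_mul_self_mul_cfc (T : H →L[ℂ] H) {g : ℝ → ℝ} (hg : Continuous g) :
    adjoint (T * cfc g (adjoint T * T)) * (T * cfc g (adjoint T * T)) =
      cfc (fun x => x * g x ^ 2) (adjoint T * T) := by
  have h := adjoint_mul_self_isSelfAdjoint T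
  set A := adjoint T * T with hA
  have h1 : adjoint (T * cfc g A) = cfc g A * adjoint T := by
    change star (T * cfc g A) = _
    rw [star_mul, (cfc_predicate g A : IsSelfAdjoint _).star_eq]; rfl
  calc _ = cfc g A * (A * cfc g A) := by rw [h1, hA]; simp only [mul_assoc]
    _ = cfc g A * (cfc (fun x => x) A * cfc g A) := by rw [cfc_id' ℝ A]
    _ = _ := by
      rw [← cfc_mul _ _ _ (by fun_prop) hg.continuousOn,
        ← cfc_mul _ _ _ hg.continuousOn (by fun_prop)]
      exact cfc_congr fun x _ => by ring

lemma norm_sq_mul_cfc_le (T : H →L[ℂ] H) {g : ℝ → ℝ} (hg : Continuous g) {c : ℝ}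
    (hc : ∀ x, 0 ≤ x → x * g x ^ 2 ≤ c) : ‖T * cfc g (adjoint T * T)‖ ^ 2 ≤ c := by
  have hc0 : 0 ≤ c := by simpa using hc 0 le_rfl
  rw [sq, ← CStarRing.norm_star_mul_self]
  change ‖adjoint (T * cfc g (adjoint T * T)) * (T * cfc g (adjoint T * T))‖ ≤ c
  rw [adjoint_mul_self_mul_cfc T hg]
  refine norm_cfc_le hc0 fun x hx => ?_
  have h0 := spectrum_adjoint_mul_self_nonneg T hx
  rw [Real.norm_of_nonneg (by positivity)]
  exact hc x h0

lemma tendsto_mul_cfc (T : H →L[ℂ] H) {g : ℝ → ℝ → ℝ} (hg : ∀ ε > 0, Continuous (g ε))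
    (hc : ∀ ε > 0, ∀ x, 0 ≤ x → x * (1 - g ε x) ^ 2 ≤ ε) :
    Tendsto (fun ε => T * cfc (g ε) (adjoint T * T)) (𝓝[>] 0) (𝓝 T) := by
  have h := adjoint_mul_self_isSelfAdjoint T
  rw [tendsto_iff_norm_sub_tendsto_zero]
  have hlim : Tendsto Real.sqrt (𝓝[>] 0) (𝓝 0) := by
    simpa using (Real.continuous_sqrt.tendsto 0).mono_left nhdsWithin_le_nhds
  refine squeeze_zero' (.of_forall fun _ => norm_nonneg _) ?_ hlim
  filter_upwards [self_mem_nhdsWithin] with ε hε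
  rw [norm_sub_rev]
  refine Real.le_sqrt_of_sq_le ?_
  have := norm_sq_mul_cfc_le T (g := fun x => 1 - g ε x) (continuous_const.sub (hg ε hε)) (hc ε hε)
  rwa [cfc_sub _ _ _ (by fun_prop) (hg ε hε).continuousOn, cfc_const_one ℝ _, mul_sub,
    mul_one] at this

/-- The diagonal of `Z₁ T Z₂` is absolutely summable for trace class `T`, with sum at most
`‖Z₁‖ ‖Z₂‖ tr |T|`. -/
lemma tsum_enorm_inner_mul_mul_le {ι : Type*} (b : HilbertBasis ι ℂ H) (Z₁ T Z₂ : H →L[ℂ] H) :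
    ∑' i, ‖⟪b i, (Z₁ * T * Z₂) (b i)⟫_ℂ‖ₑ ≤ ‖Z₁‖ₑ * ‖Z₂‖ₑ * trAbsPow b T 1 := by
  rw [ENNReal.tsum_eq_iSup_sum]
  refine iSup_le fun s => ?_
  let m : ℝ → ℝ → ℝ := fun ε x => max x ε ^ (-(1 / 2) : ℝ)
  have hm : ∀ ε > 0, Continuous (m ε) := fun ε hε =>
    (continuous_id.max continuous_const).rpow_const fun x => .inl (lt_max_of_lt_right hε).ne'
  have hm2 : ∀ ε > 0, ∀ x, m ε x ^ 2 = (max x ε)⁻¹ := fun ε hε x => by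
    have : 0 < max x ε := lt_max_of_lt_right hε
    rw [← Real.rpow_natCast, ← Real.rpow_mul this.le]
    norm_num [Real.rpow_neg_one]
  let V : ℝ → H →L[ℂ] H := fun ε => T * cfc (m ε) (adjoint T * T)
  have hhalf : Continuous fun x : ℝ => x ^ (1 / 2 : ℝ) := Real.continuous_rpow_const (by norm_num)
  have hV : ∀ ε > 0, ‖V ε‖ₑ ≤ 1 := fun ε hε => by
    have : ‖V ε‖ ^ 2 ≤ 1 := norm_sq_mul_cfc_le T (hm ε hε) fun x hx => by
      rw [hm2 ε hε, ← div_eq_mul_inv]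
      exact div_le_one_of_le₀ (le_max_left _ _) (hx.trans (le_max_left _ _))
    rw [← ofReal_norm, ENNReal.ofReal_le_one]
    nlinarith [norm_nonneg (V ε)]
  have hlim : Tendsto (fun ε => V ε * absPow T 1) (𝓝[>] 0) (𝓝 T) := by
    have := tendsto_mul_cfc T (g := fun ε x => m ε x * x ^ (1 / 2 : ℝ))
      (fun ε hε => (hm ε hε).mul hhalf) fun ε hε x hx => by
        have hmx : 0 < max x ε := lt_max_of_lt_right hε
        have h2 : (m ε x * x ^ (1 / 2 : ℝ)) ^ 2 = x / max x ε := by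
          rw [mul_pow, hm2 ε hε, ← Real.rpow_natCast, ← Real.rpow_mul hx]
          norm_num; ring
        have h0 : 0 ≤ m ε x * x ^ (1 / 2 : ℝ) := by positivity
        set t := m ε x * x ^ (1 / 2 : ℝ)
        rcases le_total x ε with h | h
        · have : t ^ 2 ≤ 1 := by rw [h2]; exact div_le_one_of_le₀ (le_max_left _ _) hmx.le
          nlinarith [mul_le_mul h (show (1 - t) ^ 2 ≤ 1 by nlinarith) (by positivity) hε.le]
        · have : t ^ 2 = 1 := by rw [h2, max_eq_left h, div_self (hε.trans_le h).ne']
          have : t = 1 := by nlinarith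
          simp [this, hε.le]
    refine this.congr' ?_
    filter_upwards [self_mem_nhdsWithin] with ε hε
    rw [cfc_mul _ _ _ (hm ε hε).continuousOn hhalf.continuousOn, ← mul_assoc]
    rfl
  have hc : Continuous fun B : H →L[ℂ] H => ∑ i ∈ s, ‖⟪b i, (Z₁ * B * Z₂) (b i)⟫_ℂ‖ₑ := by
    refine continuous_finsetSum _ fun i _ => continuous_enorm.comp ?_
    refine continuous_const.inner ?_
    exact (Z₁.continuous.comp (ContinuousLinearMap.apply ℂ H (Z₂ (b i))).continuous)
  refine le_of_tendsto ((hc.tendsto T).comp hlim) ?_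
  filter_upwards [self_mem_nhdsWithin] with ε hε
  have hP : absPow T 1 = absPow T (1 / 2) * absPow T (1 / 2) := by
    rw [absPow_mul_absPow T (by norm_num) (by norm_num), add_halves]
  simp only [Function.comp_apply]
  rw [hP, ← mul_assoc Z₁, trAbsPow_eq_tsum_enorm_sq b T zero_le_one]
  refine (b.sum_enorm_inner_mul_sq_mul_le (absPow_isSelfAdjoint T _) _ _ s).trans ?_
  gcongr
  calc ‖Z₁ * V ε‖ₑ ≤ ‖Z₁‖ₑ * ‖V ε‖ₑ := opENorm_comp_le _ _
    _ ≤ ‖Z₁‖ₑ := mul_le_of_le_one_right' (hV ε hε)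

lemma summable_inner_mul_mul {ι : Type*} (b : HilbertBasis ι ℂ H) (Z₁ Z₂ : H →L[ℂ] H)
    {T : H →L[ℂ] H} (hT : trAbsPow b T 1 ≠ ∞) :
    Summable fun i => ⟪b i, (Z₁ * T * Z₂) (b i)⟫_ℂ := by
  refine Summable.of_enorm ?_
  exact ((tsum_enorm_inner_mul_mul_le b Z₁ T Z₂).trans_lt
    (ENNReal.mul_lt_top (ENNReal.mul_lt_top enorm_lt_top enorm_lt_top) hT.lt_top)).ne

lemma enorm_traceC_mul_mul_le {ι : Type*} (b : HilbertBasis ι ℂ H) (Z₁ T Z₂ : H →L[ℂ] H) :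
    ‖traceC b (Z₁ * T * Z₂)‖ₑ ≤ ‖Z₁‖ₑ * ‖Z₂‖ₑ * trAbsPow b T 1 :=
  enorm_tsum_le_tsum_enorm.trans (tsum_enorm_inner_mul_mul_le b Z₁ T Z₂)

/-- `Y ↦ tr (K Y)` as a bounded functional, for trace class `K`. -/
def traceMulLeft {ι : Type*} (b : HilbertBasis ι ℂ H) (K : H →L[ℂ] H)
    (hK : trAbsPow b K 1 ≠ ∞) : (H →L[ℂ] H) →L[ℂ] ℂ :=
  LinearMap.mkContinuous
    { toFun := fun Y => traceC b (K * Y)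
      map_add' := fun Y Z => by
        have h : ∀ Y, Summable fun i => ⟪b i, (K * Y) (b i)⟫_ℂ := fun Y => by
          simpa using summable_inner_mul_mul b 1 Y hK
        simp only [traceC, mul_add, add_apply, inner_add_right]
        exact (h Y).tsum_add (h Z)
      map_smul' := fun c Y => by
        simp [traceC, tsum_mul_left] }
    (‖(1 : H →L[ℂ] H)‖ * (trAbsPow b K 1).toReal) fun Y => by
      have := enorm_traceC_mul_mul_le b 1 K Y
      rw [one_mul] at this
      have := ENNReal.toReal_mono
        (ENNReal.mul_ne_top (ENNReal.mul_ne_top enorm_ne_top enorm_ne_top) hK) this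
      simp only [ENNReal.toReal_mul, toReal_enorm] at this
      calc _ ≤ _ := this
        _ = _ := by ring

lemma absPow_apply_eq_zero (T : H →L[ℂ] H) {q : ℝ} (hq : 0 < q) {x : H} (hx : T x = 0) :
    absPow T q x = 0 := by
  have hbig : ∀ r : ℝ, 2 ≤ r → absPow T r x = 0 := fun r hr => by
    rw [← sub_add_cancel r 2, ← absPow_mul_absPow T (by linarith) zero_le_two, absPow_two]
    change absPow T (r - 2) (adjoint T (T x)) = 0
    simp [hx]
  have hdouble : ∀ r : ℝ, 0 ≤ r → absPow T (r + r) x = 0 → absPow T r x = 0 := fun r hr h => by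
    have hs : adjoint (absPow T r) = absPow T r := absPow_isSelfAdjoint T r
    rw [← absPow_mul_absPow T hr hr] at h
    rw [← inner_self_eq_zero (𝕜 := ℂ), ← adjoint_inner_right, hs]
    change ⟪x, (absPow T r * absPow T r) x⟫_ℂ = 0
    rw [h, inner_zero_right]
  have hind : ∀ (n : ℕ) (r : ℝ), 0 ≤ r → absPow T (2 ^ n * r) x = 0 → absPow T r x = 0 := by
    intro n
    induction n with
    | zero => intro r _ h; simpa using h
    | succ n ih =>
      intro r hr h
      refine hdouble r hr (ih _ (by positivity) ?_)
      convert h using 3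
      ring
  obtain ⟨n, hn⟩ := pow_unbounded_of_one_lt (2 / q) one_lt_two
  exact hind n q hq.le (hbig _ ((div_lt_iff₀ hq).mp hn).le)

lemma HilbertBasis.tsum_enorm_apply_sq_ne_top {ι : Type*} (b : HilbertBasis ι ℂ H)
    (S : H →L[ℂ] H) [FiniteDimensional ℂ (LinearMap.range (S : H →ₗ[ℂ] H))] :
    ∑' i, ‖S (b i)‖ₑ ^ 2 ≠ ∞ := by
  set u := stdOrthonormalBasis ℂ (LinearMap.range (S : H →ₗ[ℂ] H))
  have h : ∀ x, ‖S x‖ₑ ^ 2 = ∑ j, ‖⟪x, adjoint S (u j : H)⟫_ℂ‖ₑ ^ 2 := fun x => by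
    have := u.sum_sq_norm_inner_right ⟨S x, LinearMap.mem_range_self _ x⟩
    simp only [Submodule.coe_inner, Submodule.coe_norm] at this
    rw [← ofReal_norm, ← ENNReal.ofReal_pow (norm_nonneg _), ← this,
      ENNReal.ofReal_sum_of_nonneg fun _ _ => by positivity]
    refine Finset.sum_congr rfl fun j _ => ?_
    rw [ENNReal.ofReal_pow (norm_nonneg _), ofReal_norm, adjoint_inner_right, ← inner_conj_symm,
      RCLike.enorm_conj]
  simp_rw [h]
  rw [Summable.tsum_finsetSum fun _ _ => ENNReal.summable]
  simp_rw [b.tsum_enorm_inner_sq]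
  exact (ENNReal.sum_lt_top.mpr fun _ _ => ENNReal.pow_lt_top enorm_lt_top).ne

lemma trAbsPow_ne_top_of_finiteDimensional_range {ι : Type*} (b : HilbertBasis ι ℂ H)
    (K : H →L[ℂ] H) (hK : FiniteDimensional ℂ (LinearMap.range (K : H →ₗ[ℂ] H))) {q : ℝ}
    (hq : 0 < q) : trAbsPow b K q ≠ ∞ := by
  rw [trAbsPow_eq_tsum_enorm_sq b K hq.le]
  set S := absPow K (q / 2)
  have hker : LinearMap.ker (K : H →ₗ[ℂ] H) ≤ LinearMap.ker (S : H →ₗ[ℂ] H) := fun x hx =>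
    absPow_apply_eq_zero K (half_pos hq) hx
  have h1 : Module.Finite ℂ (H ⧸ LinearMap.ker (K : H →ₗ[ℂ] H)) :=
    Module.Finite.equiv (LinearMap.quotKerEquivRange (K : H →ₗ[ℂ] H)).symm
  have h2 : Module.Finite ℂ (H ⧸ LinearMap.ker (S : H →ₗ[ℂ] H)) :=
    Module.Finite.of_surjective _ (Submodule.factor_surjective hker)
  have h3 : FiniteDimensional ℂ (LinearMap.range (S : H →ₗ[ℂ] H)) :=
    Module.Finite.equiv (LinearMap.quotKerEquivRange (S : H →ₗ[ℂ] H))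
  exact b.tsum_enorm_apply_sq_ne_top S

/-- A continuous cutoff `max (x - ε) 0 / max x ε` vanishing on `(-∞, ε]` and tending to `1`. -/
def cutoff (ε x : ℝ) : ℝ := max (x - ε) 0 / max x ε

/-- The logarithm, made constant below `ε`. -/
def logCutoff (ε x : ℝ) : ℝ := Real.log (max x ε)

lemma continuous_cutoff {ε : ℝ} (hε : 0 < ε) : Continuous (cutoff ε) :=
  ((continuous_id.sub continuous_const).max continuous_const).div
    (continuous_id.max continuous_const) fun _ => (lt_max_of_lt_right hε).ne'

lemma continuous_logCutoff {ε : ℝ} (hε : 0 < ε) : Continuous (logCutoff ε) :=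
  (continuous_id.max continuous_const).log fun _ => (lt_max_of_lt_right hε).ne'

lemma cutoff_nonneg {ε : ℝ} (hε : 0 < ε) (x : ℝ) : 0 ≤ cutoff ε x :=
  div_nonneg (le_max_right _ _) (lt_max_of_lt_right hε).le

lemma cutoff_le_one {ε : ℝ} (hε : 0 < ε) (x : ℝ) : cutoff ε x ≤ 1 :=
  div_le_one_of_le₀ (max_le_max (by linarith) hε.le) (lt_max_of_lt_right hε).le

lemma cutoff_of_le {ε x : ℝ} (hx : x ≤ ε) : cutoff ε x = 0 := by
  simp [cutoff, hx]

lemma mul_one_sub_cutoff_sq_le {ε : ℝ} (hε : 0 < ε) (x : ℝ) :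
    x * (1 - cutoff ε x) ^ 2 ≤ ε := by
  rcases le_total x ε with h | h
  · simpa [cutoff_of_le h] using h
  · have hx' : 0 < x := hε.trans_le h
    have : 1 - cutoff ε x = ε / x := by
      rw [cutoff, max_eq_left h, max_eq_left (by linarith)]
      field_simp; ring
    rw [this, show x * (ε / x) ^ 2 = ε * (ε / x) by field_simp]
    exact mul_le_of_le_one_right hε.le (div_le_one_of_le₀ h hx'.le)

lemma mul_cutoff_sq_mul_exp {ε : ℝ} (hε : 0 < ε) (x r : ℝ) :
    x * (cutoff ε x ^ 2 * Real.exp ((r - 1) * logCutoff ε x)) = cutoff ε x ^ 2 * x ^ r := by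
  rcases le_total x ε with h | h
  · simp [cutoff_of_le h]
  · have hx' : 0 < x := hε.trans_le h
    rw [logCutoff, max_eq_left h, mul_comm (r - 1), ← Real.rpow_def_of_pos hx',
      Real.rpow_sub_one hx'.ne']
    field_simp

/-- The analytic family `W_z` for which `T W_z` is a cut-off version of `U |T|^(q z)`, where
`T = U |T|` is the polar decomposition. -/
def interpFactor (T : H →L[ℂ] H) (q ε : ℝ) (z : ℂ) : H →L[ℂ] H :=
  cfc (cutoff ε) (adjoint T * T) *
    NormedSpace.exp (((q * z - 1) / 2) • cfc (logCutoff ε) (adjoint T * T))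

lemma differentiable_interpFactor (T : H →L[ℂ] H) (q ε : ℝ) :
    Differentiable ℂ (interpFactor T q ε) := by
  have h : Differentiable ℂ fun w : ℂ =>
      NormedSpace.exp (w • cfc (logCutoff ε) (adjoint T * T)) := fun w =>
    (hasDerivAt_exp_smul_const (𝕂 := ℂ) _ w).differentiableAt
  have hw : Differentiable ℂ fun z : ℂ => ((q * z - 1) / 2) := by fun_prop
  exact (h.comp hw).const_mul _

lemma interpFactor_inv (T : H →L[ℂ] H) {q : ℝ} (hq : q ≠ 0) (ε : ℝ) :
    interpFactor T q ε (q : ℂ)⁻¹ = cfc (cutoff ε) (adjoint T * T) := by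
  simp [interpFactor, hq]

lemma tendsto_mul_interpFactor_inv (T : H →L[ℂ] H) {q : ℝ} (hq : q ≠ 0) :
    Tendsto (fun ε => T * interpFactor T q ε (q : ℂ)⁻¹) (𝓝[>] 0) (𝓝 T) := by
  simp_rw [interpFactor_inv T hq]
  exact tendsto_mul_cfc T (fun _ hε => continuous_cutoff hε)
    fun _ hε x _ => mul_one_sub_cutoff_sq_le hε x

lemma exp_smul_cfc {A : H →L[ℂ] H} {f : ℝ → ℝ} (hf : Continuous f) (r : ℝ) (hA : IsSelfAdjoint A) :
    NormedSpace.exp ((r : ℂ) • cfc f A) = cfc (fun x => Real.exp (r * f x)) A := by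
  rw [Complex.coe_smul, ← cfc_smul r f A hf.continuousOn,
    ← CFC.real_exp_eq_normedSpace_exp (cfc_predicate _ _),
    ← cfc_comp' Real.exp _ A (by fun_prop) (by fun_prop)]
  rfl

/-- `W_z* B W_z` for `B` in the functional calculus of `T* T` only depends on the real part
of `z`. -/
lemma star_interpFactor_mul_cfc_mul_interpFactor (T : H →L[ℂ] H) (q : ℝ) {ε : ℝ} (hε : 0 < ε)
    (z : ℂ) {g : ℝ → ℝ} (hg : Continuous g) :
    star (interpFactor T q ε z) * (cfc g (adjoint T * T) * interpFactor T q ε z) =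
      cfc (fun x => g x * (cutoff ε x ^ 2 * Real.exp ((q * z.re - 1) * logCutoff ε x)))
        (adjoint T * T) := by
  have hA := adjoint_mul_self_isSelfAdjoint T
  unfold interpFactor
  set A := adjoint T * T
  set c : ℂ := (q * z - 1) / 2 with hc
  set L := cfc (logCutoff ε) A
  have hL : star L = L := (cfc_predicate (logCutoff ε) A : IsSelfAdjoint _)
  have hf : star (cfc (cutoff ε) A) = cfc (cutoff ε) A :=
    (cfc_predicate (cutoff ε) A : IsSelfAdjoint _)
  have hcomm : ∀ (h : ℝ → ℝ) (w : ℂ), Commute (NormedSpace.exp (w • L)) (cfc h A) := fun h w =>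
    ((cfc_commute_cfc (logCutoff ε) h A).smul_left w).exp_left
  have hadd : NormedSpace.exp (star c • L) * NormedSpace.exp (c • L) =
      cfc (fun x => Real.exp ((q * z.re - 1) * logCutoff ε x)) A := by
    let : NormedAlgebra ℚ (H →L[ℂ] H) := .restrictScalars ℚ ℂ _
    rw [← NormedSpace.exp_add_of_commute (((Commute.refl L).smul_left _).smul_right _),
      ← add_smul, ← exp_smul_cfc (continuous_logCutoff hε) _ hA]
    congr 2
    apply Complex.ext
    · simp [hc]
    · simp [hc]; ring
  have hcut := continuous_cutoff hε
  have hlog := continuous_logCutoff hε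
  calc _ = NormedSpace.exp (star c • L) * cfc (cutoff ε) A * (cfc g A * cfc (cutoff ε) A) *
        NormedSpace.exp (c • L) := by
        rw [star_mul, hf, NormedSpace.star_exp, star_smul, hL]
        simp only [mul_assoc]
    _ = cfc (cutoff ε) A * (cfc g A * cfc (cutoff ε) A) *
        (NormedSpace.exp (star c • L) * NormedSpace.exp (c • L)) := by
        rw [(hcomm _ _).eq, mul_assoc (cfc (cutoff ε) A),
          ((hcomm g (star c)).mul_right (hcomm (cutoff ε) (star c))).eq]
        simp only [mul_assoc]
    _ = _ := by
        rw [hadd, ← cfc_mul _ _ _ hg.continuousOn hcut.continuousOn,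
          ← cfc_mul _ _ _ hcut.continuousOn (by fun_prop),
          ← cfc_mul _ _ _ (by fun_prop) (by fun_prop)]
        exact cfc_congr fun x _ => by ring

lemma adjoint_mul_interpFactor_mul_self (T : H →L[ℂ] H) {q ε : ℝ} (hε : 0 < ε) (z : ℂ) :
    adjoint (T * interpFactor T q ε z) * (T * interpFactor T q ε z) =
      cfc (fun x => cutoff ε x ^ 2 * x ^ (q * z.re)) (adjoint T * T) := by
  have hA := adjoint_mul_self_isSelfAdjoint T
  have h := star_interpFactor_mul_cfc_mul_interpFactor T q hε z continuous_id
  rw [cfc_id ℝ (adjoint T * T)] at h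
  have h1 : adjoint (T * interpFactor T q ε z) = star (interpFactor T q ε z) * adjoint T :=
    star_mul T _
  rw [h1, mul_assoc, ← mul_assoc (adjoint T), h]
  exact cfc_congr fun x _ => mul_cutoff_sq_mul_exp hε x _

lemma norm_mul_interpFactor_le_one (T : H →L[ℂ] H) {q ε : ℝ} (hε : 0 < ε) {z : ℂ}
    (hz : z.re = 0) : ‖T * interpFactor T q ε z‖ ≤ 1 := by
  have h : ‖T * interpFactor T q ε z‖ * ‖T * interpFactor T q ε z‖ ≤ 1 := by
    rw [← CStarRing.norm_star_mul_self]
    change ‖adjoint (T * interpFactor T q ε z) * (T * interpFactor T q ε z)‖ ≤ 1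
    rw [adjoint_mul_interpFactor_mul_self T hε, hz]
    refine norm_cfc_le zero_le_one fun x _ => ?_
    have h0 := cutoff_nonneg hε x
    simpa [abs_of_nonneg h0] using cutoff_le_one hε x
  nlinarith [norm_nonneg (T * interpFactor T q ε z)]

lemma trAbsPow_mul_interpFactor_le {ι : Type*} (b : HilbertBasis ι ℂ H) (T : H →L[ℂ] H)
    {q ε : ℝ} (hq : 0 < q) (hε : 0 < ε) {z : ℂ} (hz : z.re = 1) :
    trAbsPow b (T * interpFactor T q ε z) 1 ≤ trAbsPow b T q := by
  have hA := adjoint_mul_self_isSelfAdjoint T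
  have hcut := continuous_cutoff hε
  have hqc : Continuous fun x : ℝ => x ^ q := Real.continuous_rpow_const hq.le
  have hqc' : Continuous fun x : ℝ => x ^ (q / 2) := Real.continuous_rpow_const (by positivity)
  have hhalf : Continuous fun x : ℝ => x ^ (1 / 2 : ℝ) := Real.continuous_rpow_const (by norm_num)
  have hle : absPow (T * interpFactor T q ε z) 1 ≤ absPow T q := by
    have hg : Continuous fun x : ℝ => cutoff ε x ^ 2 * x ^ q := (hcut.pow 2).mul hqc
    have hcomp := cfc_comp' (fun x : ℝ => x ^ (1 / 2 : ℝ)) (fun x => cutoff ε x ^ 2 * x ^ q)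
      (adjoint T * T) hhalf.continuousOn hg.continuousOn hA
    rw [absPow, adjoint_mul_interpFactor_mul_self T hε, hz, mul_one, ← hcomp, absPow]
    refine cfc_mono (fun x hx => ?_) (hhalf.comp hg).continuousOn hqc'.continuousOn
    have hx0 := spectrum_adjoint_mul_self_nonneg T hx
    have hc0 := cutoff_nonneg hε x
    rw [Real.mul_rpow (by positivity) (by positivity), ← Real.rpow_natCast,
      ← Real.rpow_mul hc0, ← Real.rpow_mul hx0]
    norm_num
    rw [mul_one_div]
    exact mul_le_of_le_one_left (by positivity) (cutoff_le_one hε x)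
  refine ENNReal.tsum_le_tsum fun i => ENNReal.ofReal_le_ofReal ?_
  have := ((le_def _ _).mp hle).re_inner_nonneg_right (b i)
  simpa [inner_sub_right] using this

lemma exists_bound_interpFactor (T : H →L[ℂ] H) (q : ℝ) {ε : ℝ} (hε : 0 < ε) :
    ∃ C, ∀ z : ℂ, z.re ∈ Set.Icc (0 : ℝ) 1 → ‖interpFactor T q ε z‖ ≤ C := by
  have hA := adjoint_mul_self_isSelfAdjoint T
  have h : ∀ z : ℂ, ‖interpFactor T q ε z‖ = ‖interpFactor T q ε z.re‖ := fun z => by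
    have h1 : ∀ w : ℂ, ‖interpFactor T q ε w‖ * ‖interpFactor T q ε w‖ =
        ‖cfc (fun x => 1 * (cutoff ε x ^ 2 * Real.exp ((q * w.re - 1) * logCutoff ε x)))
          (adjoint T * T)‖ := fun w => by
      rw [← star_interpFactor_mul_cfc_mul_interpFactor T q hε w continuous_const,
        cfc_const_one ℝ (adjoint T * T), one_mul, CStarRing.norm_star_mul_self]
    have h2 := (h1 z).trans (by simpa using (h1 z.re).symm)
    exact (mul_self_inj (norm_nonneg _) (norm_nonneg _)).mp h2
  obtain ⟨C, hC⟩ := isCompact_Icc.exists_bound_of_continuousOn (s := Set.Icc (0 : ℝ) 1)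
    ((differentiable_interpFactor T q ε).continuous.comp Complex.continuous_ofReal).continuousOn
  exact ⟨C, fun z hz => (h z).trans_le (hC _ hz)⟩

lemma trAbsPow_map_le {ι : Type*} (b : HilbertBasis ι ℂ H)
    {N : (H →L[ℂ] H) →L[ℂ] (H →L[ℂ] H)} (hN : trClassOpNorm b N ≠ ∞) {T : H →L[ℂ] H}
    (hT : trAbsPow b T 1 ≠ ∞) :
    trAbsPow b (N T) 1 ≤ trClassOpNorm b N * trAbsPow b T 1 := by
  have hne : {C : ℝ≥0∞ | ∀ T, trAbsPow b (N T) 1 ≤ C * trAbsPow b T 1}.Nonempty := by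
    by_contra h
    rw [Set.not_nonempty_iff_eq_empty] at h
    exact hN (by rw [trClassOpNorm, h, sInf_empty])
  rw [trClassOpNorm, sInf_eq_iInf', ENNReal.iInf_mul' (by simp [hT]) fun _ => hne.to_subtype]
  exact le_iInf fun C => C.2 T

/-- The three lines bound for the cut-off operators. -/
lemma enorm_traceC_interpFactor_le {ι : Type*} (b : HilbertBasis ι ℂ H) {p : ℝ} (hp : 1 < p)
    {N : (H →L[ℂ] H) →L[ℂ] (H →L[ℂ] H)} (hN : trClassOpNorm b N ≠ ∞) {X K : H →L[ℂ] H}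
    (hX : trAbsPow b X p ≠ ∞) (hK₁ : trAbsPow b K 1 ≠ ∞)
    (hK : trAbsPow b K (p / (p - 1)) ≠ ∞) {ε : ℝ} (hε : 0 < ε) :
    ‖traceC b (K * interpFactor K (p / (p - 1)) ε ((p / (p - 1) : ℝ) : ℂ)⁻¹ *
        N (X * interpFactor X p ε (p : ℂ)⁻¹))‖ₑ ≤
      (ENNReal.ofReal ‖N‖ * trAbsPow b K (p / (p - 1))) ^ (1 - 1 / p) *
        (trClassOpNorm b N * trAbsPow b X p) ^ (1 / p) := by
  have hp0 : 0 < p := by linarith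
  have hp1 : 0 < p - 1 := by linarith
  set q := p / (p - 1) with hq
  have hq0 : 0 < q := by positivity
  let F : ℂ → ℂ := fun z =>
    traceC b (K * interpFactor K q ε (1 - z) * N (X * interpFactor X p ε z))
  set M₀ := ENNReal.ofReal ‖N‖ * trAbsPow b K q
  set M₁ := trClassOpNorm b N * trAbsPow b X p
  have hM₀ : M₀ ≠ ∞ := ENNReal.mul_ne_top ENNReal.ofReal_ne_top hK
  have hM₁ : M₁ ≠ ∞ := ENNReal.mul_ne_top hN hX
  have hFeq : F = fun z => traceMulLeft b K hK₁
      (interpFactor K q ε (1 - z) * N (X * interpFactor X p ε z)) := by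
    ext z
    change traceC b _ = traceC b _
    rw [mul_assoc]
  have hFd : Differentiable ℂ F := by
    have hWK : Differentiable ℂ fun z : ℂ => interpFactor K q ε (1 - z) :=
      (differentiable_interpFactor K q ε).comp (by fun_prop)
    have hWX : Differentiable ℂ fun z : ℂ => N (X * interpFactor X p ε z) :=
      N.differentiable.comp ((differentiable_interpFactor X p ε).const_mul X)
    rw [hFeq]
    exact (traceMulLeft b K hK₁).differentiable.comp (hWK.mul hWX)
  have hFb : BddAbove ((norm ∘ F) '' Complex.HadamardThreeLines.verticalClosedStrip 0 1) := by
    obtain ⟨C, hC⟩ := exists_bound_interpFactor K q hε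
    obtain ⟨D, hD⟩ := exists_bound_interpFactor X p hε
    refine ⟨‖traceMulLeft b K hK₁‖ * (C * (‖N‖ * (‖X‖ * D))), ?_⟩
    rintro _ ⟨z, hz, rfl⟩
    have hz' : z.re ∈ Set.Icc (0 : ℝ) 1 := hz
    have h1 := hC (1 - z) (by simpa [and_comm] using hz')
    have h2 := hD z hz'
    simp only [Function.comp_apply, hFeq]
    refine (le_opNorm _ _).trans ?_
    gcongr
    refine (norm_mul_le _ _).trans ?_
    gcongr
    · exact (norm_nonneg _).trans h1
    refine (N.le_opNorm _).trans ?_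
    gcongr
    refine (norm_mul_le _ _).trans ?_
    gcongr
  have hF₀ : ∀ z ∈ Complex.re ⁻¹' {(0 : ℝ)}, ‖F z‖ ≤ M₀.toReal := fun z hz => by
    have hz : z.re = 0 := hz
    rw [← toReal_enorm]
    refine ENNReal.toReal_mono hM₀ ?_
    have h1 := enorm_traceC_mul_mul_le b 1 (K * interpFactor K q ε (1 - z))
      (N (X * interpFactor X p ε z))
    rw [one_mul] at h1
    refine h1.trans ?_
    have hone : ‖(1 : H →L[ℂ] H)‖ₑ ≤ 1 := by
      rw [← ofReal_norm, ENNReal.ofReal_le_one]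
      exact norm_id_le
    have hNX : ‖N (X * interpFactor X p ε z)‖ₑ ≤ ENNReal.ofReal ‖N‖ := by
      rw [← ofReal_norm]
      refine ENNReal.ofReal_le_ofReal ((N.le_opNorm _).trans ?_)
      exact mul_le_of_le_one_right (norm_nonneg _) (norm_mul_interpFactor_le_one X hε hz)
    calc _ ≤ 1 * ENNReal.ofReal ‖N‖ * trAbsPow b K q := by
          gcongr
          exact trAbsPow_mul_interpFactor_le b K hq0 hε (by simp [hz])
      _ = M₀ := by rw [one_mul]
  have hF₁ : ∀ z ∈ Complex.re ⁻¹' {(1 : ℝ)}, ‖F z‖ ≤ M₁.toReal := fun z hz => by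
    have hz : z.re = 1 := hz
    rw [← toReal_enorm]
    refine ENNReal.toReal_mono hM₁ ?_
    have h1 := enorm_traceC_mul_mul_le b (K * interpFactor K q ε (1 - z))
      (N (X * interpFactor X p ε z)) 1
    rw [mul_one] at h1
    refine h1.trans ?_
    have hone : ‖(1 : H →L[ℂ] H)‖ₑ ≤ 1 := by
      rw [← ofReal_norm, ENNReal.ofReal_le_one]
      exact norm_id_le
    have hKz : ‖K * interpFactor K q ε (1 - z)‖ₑ ≤ 1 := by
      rw [← ofReal_norm, ENNReal.ofReal_le_one]
      exact norm_mul_interpFactor_le_one K hε (by simp [hz])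
    have hXz := trAbsPow_mul_interpFactor_le b X hp0 hε hz
    calc _ ≤ 1 * 1 * (trClassOpNorm b N * trAbsPow b X p) := by
          gcongr
          refine (trAbsPow_map_le b hN (ne_top_of_le_ne_top hX hXz)).trans ?_
          gcongr
      _ = M₁ := by rw [one_mul, one_mul]
  have hθ : ((p : ℂ)⁻¹).re = 1 / p := by
    rw [← Complex.ofReal_inv, Complex.ofReal_re, one_div]
  have hmem : (p : ℂ)⁻¹ ∈ Complex.HadamardThreeLines.verticalClosedStrip 0 1 := by
    change ((p : ℂ)⁻¹).re ∈ Set.Icc (0 : ℝ) 1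
    rw [hθ]
    exact ⟨by positivity, (div_le_one hp0).mpr hp.le⟩
  have hmain := Complex.HadamardThreeLines.norm_le_interp_of_mem_verticalClosedStrip₀₁' F hmem
    hFd.diffContOnCl hFb hF₀ hF₁
  have hqinv : ((q : ℝ) : ℂ)⁻¹ = 1 - (p : ℂ)⁻¹ := by
    rw [← Complex.ofReal_inv, ← Complex.ofReal_inv, ← Complex.ofReal_one, ← Complex.ofReal_sub, hq]
    congr 1
    field_simp
  have hexp : 0 ≤ 1 - 1 / p := sub_nonneg.mpr ((div_le_one hp0).mpr hp.le)
  rw [hqinv]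
  change ‖F (p : ℂ)⁻¹‖ₑ ≤ _
  rw [← ofReal_norm]
  refine (ENNReal.ofReal_le_ofReal hmain).trans_eq ?_
  rw [hθ, ENNReal.ofReal_mul (by positivity),
    ← ENNReal.ofReal_rpow_of_nonneg ENNReal.toReal_nonneg hexp,
    ← ENNReal.ofReal_rpow_of_nonneg ENNReal.toReal_nonneg (by positivity),
    ENNReal.ofReal_toReal hM₀, ENNReal.ofReal_toReal hM₁]

/-- Let `H` be a separable complex Hilbert space, `1 < p < ∞` and
`p' = p/(p−1)`.  Let `N : B(H) → B(H)` be a bounded linear map whose restriction to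
the trace class `S¹` maps `S¹` into itself boundedly.  Then for every `X ∈ S^p` and
every finite rank operator `K` on `H`,
`|tr(K N(X))| ≤ (‖N‖_{B→B} · tr |K|^{p'})^{1/p'} · (‖N‖_{S¹→S¹} · tr |X|^p)^{1/p}`. -/
theorem trace_pairing_interpolation_bound
    [TopologicalSpace.SeparableSpace H] {ι : Type*} (b : HilbertBasis ι ℂ H)
    (p : ℝ) (hp : 1 < p)
    (N : (H →L[ℂ] H) →L[ℂ] (H →L[ℂ] H))
    (hN : trClassOpNorm b N ≠ ∞)
    (X K : H →L[ℂ] H)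
    (hX : trAbsPow b X p ≠ ∞)
    (hK : FiniteDimensional ℂ (LinearMap.range (K : H →ₗ[ℂ] H))) :
    ENNReal.ofReal ‖traceC b (K * N X)‖ ≤
      (ENNReal.ofReal ‖N‖ * trAbsPow b K (p / (p - 1))) ^ (1 - 1 / p) *
        (trClassOpNorm b N * trAbsPow b X p) ^ (1 / p) := by
  have hp1 : 0 < p - 1 := by linarith
  have hq0 : 0 < p / (p - 1) := by positivity
  have hK₁ := trAbsPow_ne_top_of_finiteDimensional_range b K hK one_pos
  have hKq := trAbsPow_ne_top_of_finiteDimensional_range b K hK hq0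
  have hXlim := tendsto_mul_interpFactor_inv X (q := p) (by linarith)
  have hlim : Tendsto (fun ε => traceC b
      (K * interpFactor K (p / (p - 1)) ε ((p / (p - 1) : ℝ) : ℂ)⁻¹ *
        N (X * interpFactor X p ε (p : ℂ)⁻¹))) (𝓝[>] 0) (𝓝 (traceC b (K * N X))) := by
    set R := LinearMap.range (K : H →ₗ[ℂ] H)
    have hQ : FiniteDimensional ℂ (LinearMap.range (R.starProjection : H →ₗ[ℂ] H)) := by
      rwa [Submodule.range_starProjection]
    have hQK : R.starProjection * K = K := by
      ext x
      exact R.starProjection_eq_self_iff.mpr (LinearMap.mem_range_self _ x)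
    let τ := traceMulLeft b R.starProjection
      (trAbsPow_ne_top_of_finiteDimensional_range b _ hQ one_pos)
    have hτ : ∀ W Y : H →L[ℂ] H, τ (K * W * Y) = traceC b (K * W * Y) := fun W Y => by
      change traceC b (R.starProjection * (K * W * Y)) = _
      rw [← mul_assoc, ← mul_assoc, hQK]
    have hconv := (τ.continuous.tendsto _).comp
      ((tendsto_mul_interpFactor_inv K hq0.ne').mul ((N.continuous.tendsto X).comp hXlim))
    have hτ₁ := hτ 1 (N X)
    rw [mul_one] at hτ₁
    rw [← hτ₁]
    exact hconv.congr fun ε => hτ _ _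
  rw [ofReal_norm]
  refine le_of_tendsto hlim.enorm ?_
  filter_upwards [self_mem_nhdsWithin] with ε hε
  exact enorm_traceC_interpFactor_le b hp hN hX hK₁ hKq hε
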